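/- arXiv:1609.00830 — 3 statements merged into one kernel-verified Lean document; each statement's English description precedes it below -/
import Mathlib

section
/- Let Δ₁ and Δ₂ be simplicial complexes on disjoint vertex sets. Then the join Δ₁ ∗ Δ₂ is Cohen-Macaulay over a field k if and only if both Δ₁ and Δ₂ are Cohen-Macaulay over k. -/
open Finset

/-- An abstract simplicial complex on the vertex type `V`: a collection of
finite subsets of `V` (the faces) closed under passing to subsets. -/
structure SComplex (V : Type*) where
  faces : Set (Finset V)
  down_closed : ∀ ⦃F G : Finset V⦄, F ∈ faces → G ⊆ F → G ∈ faces

namespace SComplex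

variable {V : Type*} [DecidableEq V]

/-- The vertex set of a simplicial complex. -/
def vertexSet (Δ : SComplex V) : Set V := {v | {v} ∈ Δ.faces}

/-- A facet is a maximal face. -/
def IsFacet (Δ : SComplex V) (F : Finset V) : Prop :=
  F ∈ Δ.faces ∧ ∀ G ∈ Δ.faces, F ⊆ G → F = G

/-- A complex is pure if all of its facets have the same dimension (cardinality). -/
def Pure (Δ : SComplex V) : Prop :=
  ∀ ⦃F G⦄, Δ.IsFacet F → Δ.IsFacet G → F.card = G.card

/-- One more than the dimension: the largest cardinality of a face of `Δ`.
So `Δ.dimSucc = d` means `Δ` has dimension `d - 1`. -/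
noncomputable def dimSucc (Δ : SComplex V) : ℕ :=
  sSup {n | ∃ F ∈ Δ.faces, F.card = n}

/-- The link of a face `F` : `link Δ F = {G ∈ Δ : G ∪ F ∈ Δ, G ∩ F = ∅}`. -/
def link (Δ : SComplex V) (F : Finset V) : SComplex V where
  faces := {G | G ∈ Δ.faces ∧ Disjoint G F ∧ G ∪ F ∈ Δ.faces}
  down_closed := by
    rintro G H ⟨hG, hdis, hGF⟩ hHG
    exact ⟨Δ.down_closed hG hHG, Finset.disjoint_of_subset_left hHG hdis,
      Δ.down_closed hGF (Finset.union_subset_union_left hHG)⟩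

/-- A complex is connected if it has a vertex and any two vertices are joined
by a path of edges (connectivity of the 1-skeleton). -/
def Connected (Δ : SComplex V) : Prop :=
  (∃ v, {v} ∈ Δ.faces) ∧
    ∀ a b : V, {a} ∈ Δ.faces → {b} ∈ Δ.faces →
      Relation.ReflTransGen (fun x y => x ≠ y ∧ ({x, y} : Finset V) ∈ Δ.faces) a b

/-- The join of two simplicial complexes (on disjoint vertex sets):
`Δ₁ ∗ Δ₂ = {F ∪ G : F ∈ Δ₁, G ∈ Δ₂}`. -/
def join (Δ₁ Δ₂ : SComplex V) : SComplex V where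
  faces := {H | ∃ F ∈ Δ₁.faces, ∃ G ∈ Δ₂.faces, H = F ∪ G}
  down_closed := by
    rintro H H' ⟨F, hF, G, hG, rfl⟩ hsub
    refine ⟨H' ∩ F, Δ₁.down_closed hF inter_subset_right,
      H' \ F, Δ₂.down_closed hG ?_, ?_⟩
    · intro x hx
      rcases Finset.mem_sdiff.mp hx with ⟨hx1, hx2⟩
      rcases Finset.mem_union.mp (hsub hx1) with h | h
      · exact absurd h hx2
      · exact h
    · ext x
      by_cases hx : x ∈ F <;>
        simp only [Finset.mem_union, Finset.mem_inter, Finset.mem_sdiff, hx] <;> tauto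

/-- The full simplex on a finite vertex set `W`. -/
def simplexOn (W : Finset V) : SComplex V :=
  ⟨{F | F ⊆ W}, fun _ _ hF hG => hG.trans hF⟩

/-- A shelling of `Δ`: an ordering `l` of all the facets of `Δ` such that each
facet meets the union of the previous ones in a nonempty union of
codimension-one faces of it. -/
def IsShelling (Δ : SComplex V) (l : List (Finset V)) : Prop :=
  l.Nodup ∧ (∀ F, F ∈ l ↔ Δ.IsFacet F) ∧
    ∀ i j : ℕ, j < i → i < l.length →
      ∃ m, m < i ∧ ∃ v ∈ l[i]!,
        l[i]! ∩ l[j]! ⊆ l[i]! ∩ l[m]! ∧ l[i]! ∩ l[m]! = l[i]!.erase v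

/-- A complex is shellable if its facets admit a shelling order. -/
def Shellable (Δ : SComplex V) : Prop := ∃ l, IsShelling Δ l

/-- The reduced homology `H̃₀(Δ; k)` vanishes: every `k`-linear combination of
vertices of `Δ` with coefficient sum zero is a `k`-linear combination of
boundaries of edges of `Δ`. -/
def ReducedH0Vanishes (k : Type*) [Field k] (Δ : SComplex V) : Prop :=
  ∀ f : V →₀ k, (∀ v ∈ f.support, {v} ∈ Δ.faces) → (f.sum fun _ c => c) = 0 →
    f ∈ Submodule.span k {g : V →₀ k | ∃ a b : V, a ≠ b ∧ ({a, b} : Finset V) ∈ Δ.faces ∧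
      g = Finsupp.single a 1 - Finsupp.single b 1}

end SComplex

/-- A commutative ring satisfies Serre's condition `S₂` if for every prime `p`
the localization at `p` contains, inside its maximal ideal, a regular sequence
of length at least `min 2 (dim R_p)`. -/
def RingSerreS2 (R : Type*) [CommRing R] : Prop :=
  ∀ (p : Ideal R) [p.IsPrime],
    ∃ rs : List (Localization.AtPrime p),
      (∀ r ∈ rs, r ∈ IsLocalRing.maximalIdeal (Localization.AtPrime p)) ∧
      RingTheory.Sequence.IsRegular (Localization.AtPrime p) rs ∧
      min 2 (ringKrullDim (Localization.AtPrime p)) ≤ (rs.length : WithBot ℕ∞)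

section RingSide

/-- The squarefree monomial `∏_{i ∈ F} xᵢ`. -/
noncomputable def faceMonomial (k : Type*) [CommRing k] {V : Type*} (F : Finset V) :
    MvPolynomial V k :=
  ∏ i ∈ F, MvPolynomial.X i

/-- The Stanley–Reisner ideal of a complex `Δ` on the vertex type `V`:
the ideal generated by the squarefree monomials corresponding to non-faces. -/
noncomputable def srIdeal (k : Type*) [CommRing k] {V : Type*} (Δ : SComplex V) :
    Ideal (MvPolynomial V k) :=
  Ideal.span {p | ∃ F : Finset V, F ∉ Δ.faces ∧ p = faceMonomial k F}

/-- The Stanley–Reisner ring `k[Δ]`. -/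
abbrev srRing (k : Type*) [CommRing k] {V : Type*} (Δ : SComplex V) :=
  MvPolynomial V k ⧸ srIdeal k Δ

/-- The irrelevant maximal ideal of the Stanley–Reisner ring `k[Δ]`. -/
noncomputable def srIrrelevant (k : Type*) [CommRing k] {V : Type*} (Δ : SComplex V) :
    Ideal (srRing k Δ) :=
  (Ideal.span (Set.range (MvPolynomial.X : V → MvPolynomial V k))).map
    (Ideal.Quotient.mk (srIdeal k Δ))

/-- `Δ` is Cohen–Macaulay over the field `k`: the Stanley–Reisner ring `k[Δ]`
admits a regular sequence, inside the irrelevant maximal ideal, whose length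
equals the Krull dimension of `k[Δ]`. -/
def SComplex.IsCM (k : Type*) [Field k] {V : Type*} (Δ : SComplex V) : Prop :=
  ∃ rs : List (srRing k Δ), (∀ r ∈ rs, r ∈ srIrrelevant k Δ) ∧
    RingTheory.Sequence.IsRegular (srRing k Δ) rs ∧
    ringKrullDim (srRing k Δ) = (rs.length : WithBot ℕ∞)

/-- `Δ` is `CM_t` (Cohen–Macaulay in codimension `t`) over `k`:
`Δ` is pure and `link_Δ(F)` is Cohen–Macaulay over `k` for every face `F`
with `#F ≥ t`. -/
def SComplex.IsCMt (k : Type*) [Field k] {V : Type*} [DecidableEq V] (t : ℕ)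
    (Δ : SComplex V) : Prop :=
  Δ.Pure ∧ ∀ F ∈ Δ.faces, t ≤ F.card → (Δ.link F).IsCM k

end RingSide

section CommutativeAlgebra

open RingTheory.Sequence TensorProduct

universe u

open CategoryTheory Abelian Limits Pointwise in
/-- If `Ext N M i` vanishes for `i < n + 1` and `r` is `M`-regular, then `Ext N (M ⧸ r M) i`
vanishes for `i < n`. -/
theorem subsingleton_ext_quotSMulTop {R : Type u} [CommRing R] (N M : ModuleCat.{u} R) {r : R}
    (hr : IsSMulRegular M r) {n : ℕ} (h : ∀ i < n + 1, Subsingleton (Ext N M i)) :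
    ∀ i < n, Subsingleton (Ext N (ModuleCat.of R (QuotSMulTop r M)) i) := by
  intro i hi
  have zero1 := AddCommGrpCat.isZero_of_iff_subsingleton.mpr (h i (by omega))
  have zero2 := AddCommGrpCat.isZero_of_iff_subsingleton.mpr (h (i + 1) (by omega))
  exact AddCommGrpCat.subsingleton_of_isZero <| ShortComplex.Exact.isZero_of_both_zeros
    ((Ext.covariant_sequence_exact₃' N hr.smulShortComplex_shortExact) i (i + 1) rfl)
    (zero1.eq_zero_of_src _) (zero2.eq_zero_of_tgt _)

open Pointwise in
theorem smul_top_quotSMulTop_ne_top {R M : Type*} [CommRing R] [AddCommGroup M] [Module R M]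
    {I : Ideal R} {r : R} (hr : r ∈ I) (hI : I • (⊤ : Submodule R M) ≠ ⊤) :
    I • (⊤ : Submodule R (QuotSMulTop r M)) ≠ ⊤ := by
  intro eq
  apply hI
  have := congrArg (Submodule.comap (Submodule.mkQ _)) eq
  simpa [Submodule.comap_smul_top_of_surjective I _ (Submodule.mkQ_surjective _),
    Submodule.smul_mono_left ((Ideal.span_singleton_le_iff_mem I).mpr hr),
    ← Submodule.ideal_span_singleton_smul] using this

/-- If `rs` is an `M`-regular sequence in `I` and `M ⧸ rs M` has a nonzero element killed by `I`,
then no `M`-regular sequence in `I` is longer than `rs`. -/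
theorem length_le_of_isRegular_of_socle {R : Type u} [CommRing R] [IsNoetherianRing R]
    (I : Ideal R) (rs : List R) : ∀ (M : Type u) [AddCommGroup M] [Module R M] [Module.Finite R M],
    I • (⊤ : Submodule R M) ≠ ⊤ → IsWeaklyRegular M rs → (∀ r ∈ rs, r ∈ I) →
    (∃ z : M ⧸ (Ideal.ofList rs • ⊤ : Submodule R M), z ≠ 0 ∧ ∀ a ∈ I, a • z = 0) →
    ∀ ys : List R, IsRegular M ys → (∀ y ∈ ys, y ∈ I) → ys.length ≤ rs.length := by
  induction rs with
  | nil =>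
    rintro M _ _ _ - - - ⟨z, hz, hIz⟩ ys hys hysI
    rcases ys with _ | ⟨y, ys⟩
    · simp
    · have h1 := ((isRegular_cons_iff M y ys).mp hys).1
      have e : (M ⧸ (Ideal.ofList ([] : List R) • ⊤ : Submodule R M)) ≃ₗ[R] M :=
        Submodule.quotEquivOfEqBot _ (by simp)
      exact absurd (((e.isSMulRegular_congr y).mpr h1).right_eq_zero_of_smul
        (hIz y (hysI y (by simp)))) hz
  | cons r rs ih =>
    rintro M _ _ _ hI hrs hrsI ⟨z, hz, hIz⟩ ys hys hysI
    rcases ys with _ | ⟨y, ys⟩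
    · simp
    · rw [isWeaklyRegular_cons_iff] at hrs
      have hr : r ∈ I := hrsI r (by simp)
      have hI' := smul_top_quotSMulTop_ne_top hr hI
      let N : ModuleCat.{u} R := ModuleCat.of R (Shrink.{u} (R ⧸ I))
      have hex : ∃ zs : List R, zs.length = ys.length + 1 ∧ (∀ z ∈ zs, z ∈ I) ∧
          IsRegular M zs := ⟨y :: ys, rfl, hysI, hys⟩
      have hext : ∀ i < ys.length + 1,
          Subsingleton (CategoryTheory.Abelian.Ext N (ModuleCat.of R M) i) :=
        ((ModuleCat.exists_isRegular_tfae I (ys.length + 1) (ModuleCat.of R M)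
          hI.lt_top).out 3 1).mp hex
      have hext' := subsingleton_ext_quotSMulTop N (ModuleCat.of R M) hrs.1 hext
      obtain ⟨ys', hlen, hys'I, hys'⟩ : ∃ ys' : List R, ys'.length = ys.length ∧
          (∀ y ∈ ys', y ∈ I) ∧ IsRegular (QuotSMulTop r M) ys' :=
        ((ModuleCat.exists_isRegular_tfae I ys.length
          (ModuleCat.of R (QuotSMulTop r M)) hI'.lt_top).out 1 3).mp hext'
      have e := Submodule.quotOfListConsSMulTopEquivQuotSMulTopInner M r rs
      have := ih (QuotSMulTop r M) hI' hrs.2 (fun x hx => hrsI x (by simp [hx]))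
        ⟨e z, by simpa using hz, fun a ha => by rw [← map_smul, hIz a ha, map_zero]⟩
        ys' hys' hys'I
      simp only [List.length_cons]
      omega

theorem length_le_supportDim {R : Type*} [CommRing R] (rs : List R) :
    ∀ (M : Type*) [AddCommGroup M] [Module R M] [Module.Finite R M],
    IsRegular M rs → (rs.length : WithBot ℕ∞) ≤ Module.supportDim R M := by
  induction rs with
  | nil =>
    intro M _ _ _ h
    have := h.nontrivial
    have h0 := (Module.supportDim_ne_bot_iff_nontrivial R M).mpr this
    rw [List.length_nil, Nat.cast_zero]
    exact WithBot.ne_bot_iff_exists.mp h0 |>.elim fun a ha => ha ▸ WithBot.coe_le_coe.mpr zero_le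
  | cons r rs ih =>
    intro M _ _ _ h
    rw [isRegular_cons_iff] at h
    refine le_trans ?_ (Module.supportDim_quotSMulTop_succ_le_of_notMem_minimalPrimes
      (fun _ ↦ h.1.notMem_of_mem_minimalPrimes))
    simpa using add_le_add_left (ih _ h.2) 1

theorem length_le_ringKrullDim {R : Type*} [CommRing R] {rs : List R} (h : IsRegular R rs) :
    (rs.length : WithBot ℕ∞) ≤ ringKrullDim R := by
  rw [← Module.supportDim_self_eq_ringKrullDim]
  exact length_le_supportDim rs R h

/-- In a nonzero finite module over a Noetherian ring, an ideal consisting of zero divisors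
kills a nonzero element. -/
theorem exists_ne_zero_forall_smul_eq_zero {R M : Type*} [CommRing R] [IsNoetherianRing R]
    [AddCommGroup M] [Module R M] [Module.Finite R M] (I : Ideal R)
    (h : ∀ r ∈ I, ¬ IsSMulRegular M r) : ∃ z : M, z ≠ 0 ∧ ∀ a ∈ I, a • z = 0 := by
  have hsub : (I : Set R) ⊆ ⋃ p ∈ associatedPrimes R M, (id p : Ideal R) := by
    intro r hr
    have := biUnion_associatedPrimes_eq_compl_regular R M
    simp only [id]
    rw [this]
    exact h r hr
  obtain ⟨p, hp, hIp⟩ := (Ideal.subset_union_prime_finite (associatedPrimes.finite R M) (f := id)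
    0 0 fun _ h _ _ ↦ IsAssociatedPrime.isPrime h).1 hsub
  obtain ⟨hprime, z, hz⟩ := isAssociatedPrime_iff.mp hp
  refine ⟨z, ?_, fun a ha => ?_⟩
  · rintro rfl
    apply hprime.ne_top
    rw [hz, eq_top_iff]
    intro x _
    simp [Submodule.mem_colon_singleton]
  · have := hIp ha
    rw [id, hz, Submodule.mem_colon_singleton] at this
    simpa using this

/-- Every Noetherian ring of finite dimension has a maximal regular sequence in a given
proper ideal, with a socle element in the quotient. -/
theorem exists_isRegular_socle {R : Type*} [CommRing R] [IsNoetherianRing R] (I : Ideal R)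
    (hI : I ≠ ⊤) {d : ℕ} (hd : ringKrullDim R ≤ d) :
    ∃ rs : List R, IsRegular R rs ∧ (∀ r ∈ rs, r ∈ I) ∧
      ∃ z : R, z ∉ Ideal.ofList rs ∧ ∀ a ∈ I, a * z ∈ Ideal.ofList rs := by
  classical
  have : Nontrivial R := ⟨⟨0, 1, fun h => hI (Ideal.eq_top_of_isUnit_mem I I.zero_mem
    (by rw [h]; exact isUnit_one))⟩⟩
  let P : ℕ → Prop := fun n => ∃ rs : List R, IsRegular R rs ∧ (∀ r ∈ rs, r ∈ I) ∧ rs.length = n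
  have hP0 : P 0 := ⟨[], IsRegular.nil R R, by simp, rfl⟩
  have hbound : ∀ n, P n → n ≤ d := by
    rintro n ⟨rs, hrs, -, rfl⟩
    have := (length_le_ringKrullDim hrs).trans hd
    exact_mod_cast this
  obtain ⟨rs, hrs, hrsI, hlen⟩ := Nat.findGreatest_spec (P := P) (Nat.zero_le d) hP0
  refine ⟨rs, hrs, hrsI, ?_⟩
  obtain ⟨z, hz, hIz⟩ := exists_ne_zero_forall_smul_eq_zero
      (M := R ⧸ (Ideal.ofList rs • ⊤ : Submodule R R)) I (by
    intro r hr hreg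
    have hP : P (rs.length + 1) := by
      refine ⟨rs ++ [r], ⟨?_, ?_⟩, ?_, by simp⟩
      · rw [isWeaklyRegular_append_iff, isWeaklyRegular_singleton_iff]
        exact ⟨hrs.1, hreg⟩
      · intro h
        apply hI
        rw [eq_top_iff, h]
        simp only [smul_eq_mul, Ideal.mul_top]
        rw [Ideal.ofList, Ideal.span_le]
        intro x hx
        simp only [List.mem_append, List.mem_singleton, Set.mem_ofPred_eq] at hx
        rcases hx with hx | rfl
        · exact hrsI x hx
        · exact hr
      · intro x hx
        simp only [List.mem_append, List.mem_singleton] at hx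
        rcases hx with hx | rfl
        · exact hrsI x hx
        · exact hr
    have := Nat.le_findGreatest (hbound _ hP) hP
    omega)
  obtain ⟨z, rfl⟩ := Submodule.mkQ_surjective _ z
  refine ⟨z, ?_, fun a ha => ?_⟩
  · intro h
    apply hz
    rw [Submodule.mkQ_apply, Submodule.Quotient.mk_eq_zero]
    simpa using h
  · have := hIz a ha
    rw [← map_smul, Submodule.mkQ_apply, Submodule.Quotient.mk_eq_zero] at this
    simpa using this

section TensorProduct

open Algebra.TensorProduct

variable {k : Type*} [Field k] {A B : Type*} [CommRing A] [CommRing B] [Algebra k A] [Algebra k B]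

theorem isWeaklyRegular_tensorProduct_append {rs : List A} {ss : List B}
    (hrs : IsWeaklyRegular A rs) (hss : IsWeaklyRegular B ss) :
    IsWeaklyRegular (A ⊗[k] B) (rs.map (algebraMap A (A ⊗[k] B)) ++
      ss.map (includeRight : B →ₐ[k] A ⊗[k] B)) := by
  rw [isWeaklyRegular_append_iff]
  refine ⟨hrs.of_flat, ?_⟩
  let I := Ideal.ofList rs
  have h1 : IsWeaklyRegular (B ⊗[k] (A ⧸ I)) (ss.map (algebraMap B (B ⊗[k] (A ⧸ I)))) :=
    hss.of_flat
  have hJ : I.map (algebraMap A (A ⊗[k] B)) =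
      (Ideal.ofList (rs.map (algebraMap A (A ⊗[k] B))) • ⊤ : Ideal (A ⊗[k] B)) := by
    rw [Ideal.map_ofList]; simp
  let e1 : B ⊗[k] (A ⧸ I) ≃+* (A ⊗[k] B) ⧸ I.map (algebraMap A (A ⊗[k] B)) :=
    (Algebra.TensorProduct.comm k B (A ⧸ I)).toRingEquiv.trans
      (quotientTensorEquiv (R := k) k B A I).toRingEquiv
  let e2 : B ⊗[k] (A ⧸ I) ≃+ (A ⊗[k] B) ⧸
      (Ideal.ofList (rs.map (algebraMap A (A ⊗[k] B))) • ⊤ : Ideal (A ⊗[k] B)) :=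
    (e1.trans (Ideal.quotEquivOfEq hJ)).toAddEquiv
  refine (AddEquiv.isWeaklyRegular_congr (e := e2) ?_).mp h1
  rw [List.forall₂_map_left_iff, List.forall₂_map_right_iff, List.forall₂_same]
  intro b _ x
  change (e1.trans (Ideal.quotEquivOfEq hJ)) (_ * x) = _
  rw [map_mul]
  rfl

theorem tmul_ne_zero {M N : Type*} [AddCommGroup M] [AddCommGroup N] [Module k M] [Module k N]
    {x : M} {y : N} (hx : x ≠ 0) (hy : y ≠ 0) : x ⊗ₜ[k] y ≠ 0 := by
  intro h
  apply hx
  rw [← Module.forall_dual_apply_eq_zero_iff k]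
  intro φ
  have h' := congrArg ((TensorProduct.lid k N).toLinearMap ∘ₗ φ.rTensor N) h
  simpa [hy] using h'

theorem tmul_notMem_map_sup_map {I : Ideal A} {J : Ideal B} {x : A} {y : B} (hx : x ∉ I)
    (hy : y ∉ J) : x ⊗ₜ[k] y ∉ I.map (algebraMap A (A ⊗[k] B)) ⊔
      J.map (includeRight : B →ₐ[k] A ⊗[k] B) := by
  let f : A ⊗[k] B →ₐ[k] (A ⧸ I) ⊗[k] (B ⧸ J) :=
    Algebra.TensorProduct.map (Ideal.Quotient.mkₐ k I) (Ideal.Quotient.mkₐ k J)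
  have hle : I.map (algebraMap A (A ⊗[k] B)) ⊔
      J.map (includeRight : B →ₐ[k] A ⊗[k] B) ≤ RingHom.ker f := by
    refine sup_le (Ideal.map_le_iff_le_comap.mpr fun a ha => ?_)
      (Ideal.map_le_iff_le_comap.mpr fun b hb => ?_)
    · simp [f, RingHom.mem_ker, Ideal.Quotient.eq_zero_iff_mem.mpr ha]
    · simp [f, RingHom.mem_ker, Ideal.Quotient.eq_zero_iff_mem.mpr hb]
  intro h
  have h0 : f (x ⊗ₜ y) = 0 := hle h
  simp only [f, Algebra.TensorProduct.map_tmul, Ideal.Quotient.mkₐ_eq_mk] at h0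
  exact tmul_ne_zero (mt Ideal.Quotient.eq_zero_iff_mem.mp hx)
    (mt Ideal.Quotient.eq_zero_iff_mem.mp hy) h0

theorem ofList_map_append_map (rs : List A) (ss : List B) :
    Ideal.ofList (rs.map (algebraMap A (A ⊗[k] B)) ++ ss.map (includeRight : B →ₐ[k] A ⊗[k] B)) =
      (Ideal.ofList rs).map (algebraMap A (A ⊗[k] B)) ⊔
        (Ideal.ofList ss).map (includeRight : B →ₐ[k] A ⊗[k] B) := by
  rw [Ideal.ofList_append, Ideal.map_ofList, ← Ideal.map_coe (includeRight : B →ₐ[k] A ⊗[k] B),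
    Ideal.map_ofList]
  rfl

theorem isRegular_tensorProduct_append {rs : List A} {ss : List B}
    (hrs : IsRegular A rs) (hss : IsRegular B ss) :
    IsRegular (A ⊗[k] B) (rs.map (algebraMap A (A ⊗[k] B)) ++
      ss.map (includeRight : B →ₐ[k] A ⊗[k] B)) := by
  refine ⟨isWeaklyRegular_tensorProduct_append hrs.1 hss.1, fun h => ?_⟩
  have h1 : (1 : A) ∉ Ideal.ofList rs := fun h1 =>
    hrs.2 (by simpa using ((Ideal.eq_top_iff_one _).mpr h1).symm)
  have h2 : (1 : B) ∉ Ideal.ofList ss := fun h1 =>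
    hss.2 (by simpa using ((Ideal.eq_top_iff_one _).mpr h1).symm)
  apply tmul_notMem_map_sup_map (k := k) h1 h2
  rw [smul_eq_mul, Ideal.mul_top, ofList_map_append_map] at h
  rw [← h]
  trivial

/-- The ring `R` has a regular sequence in the ideal `I` of length `dim R`. -/
def HasFullRegularSequence (R : Type*) [CommRing R] (I : Ideal R) : Prop :=
  ∃ rs : List R, (∀ r ∈ rs, r ∈ I) ∧ IsRegular R rs ∧
    ringKrullDim R = (rs.length : WithBot ℕ∞)

theorem HasFullRegularSequence.of_ringEquiv {R S : Type*} [CommRing R] [CommRing S] {I : Ideal R}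
    {J : Ideal S} (e : R ≃+* S) (hIJ : I.map e ≤ J) (h : HasFullRegularSequence R I) :
    HasFullRegularSequence S J := by
  obtain ⟨rs, hI, hreg, hdim⟩ := h
  refine ⟨rs.map e, ?_, ?_, ?_⟩
  · intro s hs
    obtain ⟨r, hr, rfl⟩ := List.mem_map.mp hs
    exact hIJ (Ideal.mem_map_of_mem e (hI r hr))
  · refine (AddEquiv.isRegular_congr (e := e.toAddEquiv) ?_).mp hreg
    rw [List.forall₂_map_right_iff, List.forall₂_same]
    intro r _ x
    exact map_mul e r x
  · rw [← ringKrullDim_eq_of_ringEquiv e, hdim, List.length_map]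

variable (k) in
/-- The ideal of `A ⊗ B` generated by the images of `I` and `J`. -/
def tensorIdeal (I : Ideal A) (J : Ideal B) : Ideal (A ⊗[k] B) :=
  I.map (algebraMap A (A ⊗[k] B)) ⊔ J.map (includeRight : B →ₐ[k] A ⊗[k] B)

theorem hasFullRegularSequence_tensorProduct_iff [IsNoetherianRing A] [IsNoetherianRing B]
    [IsNoetherianRing (A ⊗[k] B)] {I : Ideal A} {J : Ideal B} (hI : I ≠ ⊤) (hJ : J ≠ ⊤)
    {a b : ℕ} (ha : ringKrullDim A = a) (hb : ringKrullDim B = b)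
    (hab : ringKrullDim (A ⊗[k] B) = (a + b : ℕ)) :
    HasFullRegularSequence (A ⊗[k] B) (tensorIdeal k I J) ↔
      HasFullRegularSequence A I ∧ HasFullRegularSequence B J := by
  set m := tensorIdeal k I J
  have hmem : ∀ (rs : List A) (ss : List B), (∀ r ∈ rs, r ∈ I) → (∀ s ∈ ss, s ∈ J) →
      ∀ t ∈ rs.map (algebraMap A (A ⊗[k] B)) ++ ss.map (includeRight : B →ₐ[k] A ⊗[k] B),
        t ∈ m := by
    intro rs ss hrs hss t ht
    rcases List.mem_append.mp ht with ht | ht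
    · obtain ⟨r, hr, rfl⟩ := List.mem_map.mp ht
      exact Ideal.mem_sup_left (Ideal.mem_map_of_mem _ (hrs r hr))
    · obtain ⟨s, hs, rfl⟩ := List.mem_map.mp ht
      exact Ideal.mem_sup_right (Ideal.mem_map_of_mem _ (hss s hs))
  constructor
  · rintro ⟨ts, htm, htreg, htdim⟩
    obtain ⟨rs, hrs, hrsI, x, hx, hIx⟩ := exists_isRegular_socle I hI ha.le
    obtain ⟨ss, hss, hssJ, y, hy, hJy⟩ := exists_isRegular_socle J hJ hb.le
    have hreg := isRegular_tensorProduct_append (k := k) hrs hss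
    have hone : (1 : A ⊗[k] B) ∉ m := tmul_notMem_map_sup_map
      (fun h => hI ((Ideal.eq_top_iff_one _).mpr h)) (fun h => hJ ((Ideal.eq_top_iff_one _).mpr h))
    have hle := length_le_of_isRegular_of_socle m _ (A ⊗[k] B)
      (by
        intro h
        rw [smul_eq_mul, Ideal.mul_top] at h
        exact hone (h ▸ trivial))
      hreg.1 (hmem rs ss hrsI hssJ) ⟨Submodule.Quotient.mk (x ⊗ₜ y), by
        rw [ne_eq, Submodule.Quotient.mk_eq_zero, smul_eq_mul, Ideal.mul_top,
          ofList_map_append_map]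
        exact tmul_notMem_map_sup_map hx hy, by
        have : m ≤ (Ideal.ofList (rs.map (algebraMap A (A ⊗[k] B)) ++
            ss.map (includeRight : B →ₐ[k] A ⊗[k] B))).colon {x ⊗ₜ[k] y} := by
          rw [ofList_map_append_map]
          refine sup_le (Ideal.map_le_iff_le_comap.mpr fun a ha => ?_)
            (Ideal.map_le_iff_le_comap.mpr fun b hb => ?_)
          · rw [Ideal.mem_comap, Submodule.mem_colon_singleton]
            refine Ideal.mem_sup_left ?_
            have : algebraMap A (A ⊗[k] B) a • x ⊗ₜ[k] y =
                ((1 : A) ⊗ₜ[k] y) * algebraMap A (A ⊗[k] B) (a * x) := by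
              simp
            rw [this]
            exact Ideal.mul_mem_left _ _ (Ideal.mem_map_of_mem _ (hIx a ha))
          · rw [Ideal.mem_comap, Submodule.mem_colon_singleton]
            refine Ideal.mem_sup_right ?_
            have : (includeRight : B →ₐ[k] A ⊗[k] B) b • x ⊗ₜ[k] y =
                (x ⊗ₜ[k] (1 : B)) * (includeRight : B →ₐ[k] A ⊗[k] B) (b * y) := by
              simp
            rw [this]
            exact Ideal.mul_mem_left _ _ (Ideal.mem_map_of_mem _ (hJy b hb))
        intro t ht
        rw [← Submodule.Quotient.mk_smul, Submodule.Quotient.mk_eq_zero, smul_eq_mul (a := Ideal.ofList _),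
          Ideal.mul_top]
        exact Submodule.mem_colon_singleton.mp (this ht)⟩
      ts htreg htm
    have h1 := length_le_ringKrullDim hrs
    have h2 := length_le_ringKrullDim hss
    rw [ha] at h1
    rw [hb] at h2
    rw [hab] at htdim
    norm_cast at h1 h2 htdim
    simp only [List.length_append, List.length_map] at hle
    refine ⟨⟨rs, hrsI, hrs, ?_⟩, ⟨ss, hssJ, hss, ?_⟩⟩
    · rw [ha]; norm_cast; omega
    · rw [hb]; norm_cast; omega
  · rintro ⟨⟨rs, hrsI, hrs, hrd⟩, ⟨ss, hssJ, hss, hsd⟩⟩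
    refine ⟨_, hmem rs ss hrsI hssJ, isRegular_tensorProduct_append hrs hss, ?_⟩
    rw [ha] at hrd
    rw [hb] at hsd
    rw [hab]
    norm_cast at hrd hsd ⊢
    simp [hrd, hsd]

theorem prod_eq_zero_of_subset {ι M : Type*} [CommMonoidWithZero M] {f : ι → M} {s t : Finset ι}
    (hst : s ⊆ t) (h : ∏ i ∈ s, f i = 0) : ∏ i ∈ t, f i = 0 :=
  zero_dvd_iff.mp (h ▸ Finset.prod_dvd_prod_of_subset s t f hst)

theorem prod_tmul_one_add_eq_zero_left {ι : Type*} {f : ι → A} {g : ι → B} {s t : Finset ι}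
    (hst : s ⊆ t) (hf : ∏ i ∈ s, f i = 0) (hg : ∀ i ∈ s, g i = 0) :
    ∏ i ∈ t, (f i ⊗ₜ[k] (1 : B) + (1 : A) ⊗ₜ[k] g i) = 0 := by
  refine prod_eq_zero_of_subset hst ?_
  have h := congrArg (algebraMap A (A ⊗[k] B)) hf
  rw [map_prod, map_zero] at h
  refine (Finset.prod_congr rfl fun i hi => ?_).trans h
  simp [hg i hi]

theorem prod_tmul_one_add_eq_zero_right {ι : Type*} {f : ι → A} {g : ι → B} {s t : Finset ι}
    (hst : s ⊆ t) (hg : ∏ i ∈ s, g i = 0) (hf : ∀ i ∈ s, f i = 0) :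
    ∏ i ∈ t, (f i ⊗ₜ[k] (1 : B) + (1 : A) ⊗ₜ[k] g i) = 0 := by
  refine prod_eq_zero_of_subset hst ?_
  have h := congrArg (includeRight : B →ₐ[k] A ⊗[k] B) hg
  rw [map_prod, map_zero] at h
  refine (Finset.prod_congr rfl fun i hi => ?_).trans h
  simp [hf i hi]

end TensorProduct

end CommutativeAlgebra

section StanleyReisner

open TensorProduct

variable {V : Type*} {k : Type*} [Field k]

/-- The class of the variable `x_v` in the Stanley–Reisner ring. -/
noncomputable def srVar (k : Type*) [Field k] (Δ : SComplex V) (v : V) : srRing k Δ :=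
  Ideal.Quotient.mk (srIdeal k Δ) (MvPolynomial.X v)

theorem prod_srVar_eq_zero {Δ : SComplex V} {F : Finset V} (hF : F ∉ Δ.faces) :
    ∏ v ∈ F, srVar k Δ v = 0 := by
  have h : faceMonomial k F ∈ srIdeal k Δ := Ideal.subset_span ⟨F, hF, rfl⟩
  rw [← Ideal.Quotient.eq_zero_iff_mem, faceMonomial, map_prod] at h
  exact h

theorem srVar_eq_zero {Δ : SComplex V} {v : V} (hv : v ∉ Δ.vertexSet) :
    srVar k Δ v = 0 := by
  simpa using prod_srVar_eq_zero (k := k) (Δ := Δ) (F := {v}) hv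

/-- The universal property of the Stanley–Reisner ring. -/
noncomputable def srLift {S : Type*} [CommRing S] [Algebra k S] (Δ : SComplex V) (f : V → S)
    (hf : ∀ F ∉ Δ.faces, ∏ v ∈ F, f v = 0) : srRing k Δ →ₐ[k] S :=
  Ideal.Quotient.liftₐ _ (MvPolynomial.aeval f) <| by
    intro a ha
    rw [← RingHom.mem_ker]
    revert a
    change srIdeal k Δ ≤ _
    rw [srIdeal, Ideal.span_le]
    rintro _ ⟨F, hF, rfl⟩
    simp [faceMonomial, map_prod, hf F hF]

@[simp]
theorem srLift_srVar {S : Type*} [CommRing S] [Algebra k S] (Δ : SComplex V) (f : V → S)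
    (hf : ∀ F ∉ Δ.faces, ∏ v ∈ F, f v = 0) (v : V) :
    srLift (k := k) Δ f hf (srVar k Δ v) = f v :=
  MvPolynomial.aeval_X f v

theorem srRing_algHom_ext {S : Type*} [Semiring S] [Algebra k S] {Δ : SComplex V} {f g : srRing k Δ →ₐ[k] S}
    (h : ∀ v, f (srVar k Δ v) = g (srVar k Δ v)) : f = g := by
  apply Ideal.Quotient.algHom_ext
  apply MvPolynomial.algHom_ext
  exact h

theorem srIrrelevant_eq_span (Δ : SComplex V) :
    srIrrelevant k Δ = Ideal.span (Set.range (srVar k Δ)) := by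
  rw [srIrrelevant, Ideal.map_span, ← Set.range_comp]
  rfl

theorem srVar_mem_srIrrelevant (Δ : SComplex V) (v : V) : srVar k Δ v ∈ srIrrelevant k Δ := by
  rw [srIrrelevant_eq_span]
  exact Ideal.subset_span ⟨v, rfl⟩

theorem srIrrelevant_ne_top {Δ : SComplex V} (h : ∅ ∈ Δ.faces) : srIrrelevant k Δ ≠ ⊤ := by
  let φ : srRing k Δ →ₐ[k] k := srLift Δ (fun _ => 0) fun F hF =>
    have hne : F.Nonempty := Finset.nonempty_iff_ne_empty.mpr fun h0 => hF (h0 ▸ h)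
    hne.elim fun v hv => Finset.prod_eq_zero hv rfl
  have hle : srIrrelevant k Δ ≤ RingHom.ker φ := by
    rw [srIrrelevant_eq_span, Ideal.span_le]
    rintro _ ⟨v, rfl⟩
    simp [φ]
  exact fun h1 => RingHom.ker_ne_top φ (top_le_iff.mp (h1 ▸ hle))

theorem empty_mem_faces_of_nontrivial {Δ : SComplex V} (h : Nontrivial (srRing k Δ)) :
    ∅ ∈ Δ.faces := by
  by_contra h0
  simpa using prod_srVar_eq_zero (k := k) h0

theorem isCM_iff {Δ : SComplex V} :
    Δ.IsCM k ↔ HasFullRegularSequence (srRing k Δ) (srIrrelevant k Δ) :=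
  Iff.rfl

section Dimension

variable [Fintype V]

theorem ringKrullDim_mvPolynomial_finset (F : Finset V) :
    ringKrullDim (MvPolynomial F k) = (F.card : ℕ) := by
  rw [MvPolynomial.ringKrullDim_of_isNoetherianRing, ringKrullDim_eq_zero_of_field]
  simp

theorem card_le_ringKrullDim_srRing {Δ : SComplex V} {F : Finset V} (hF : F ∈ Δ.faces) :
    (F.card : WithBot ℕ∞) ≤ ringKrullDim (srRing k Δ) := by
  classical
  let f : V → MvPolynomial F k := fun v => if h : v ∈ F then MvPolynomial.X ⟨v, h⟩ else 0
  let φ : srRing k Δ →ₐ[k] MvPolynomial F k := srLift Δ f fun G hG => by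
    obtain ⟨v, hvG, hvF⟩ : ∃ v ∈ G, v ∉ F := by
      by_contra! h
      exact hG (Δ.down_closed hF h)
    exact Finset.prod_eq_zero hvG (by simp [f, hvF])
  let ψ : MvPolynomial F k →ₐ[k] srRing k Δ := MvPolynomial.aeval fun v => srVar k Δ v
  have h : φ.comp ψ = AlgHom.id k _ := by
    apply MvPolynomial.algHom_ext
    intro v
    simp [φ, ψ, f]
  rw [← ringKrullDim_mvPolynomial_finset (k := k)]
  exact ringKrullDim_le_of_surjective φ.toRingHom fun x => ⟨ψ x, DFunLike.congr_fun h x⟩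

theorem exists_ringKrullDim_quotient_le_card (Δ : SComplex V) (p : Ideal (srRing k Δ))
    [hp : p.IsPrime] : ∃ F ∈ Δ.faces, ringKrullDim (srRing k Δ ⧸ p) ≤ (F.card : ℕ) := by
  classical
  let F : Finset V := Finset.univ.filter fun v => srVar k Δ v ∉ p
  refine ⟨F, ?_, ?_⟩
  · by_contra hF
    have h : ∏ v ∈ F, srVar k Δ v ∈ p := prod_srVar_eq_zero (k := k) hF ▸ p.zero_mem
    obtain ⟨v, hv, hvp⟩ := (hp.prod_mem_iff).mp h
    exact (Finset.mem_filter.mp hv).2 hvp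
  · let q : srRing k Δ →ₐ[k] srRing k Δ ⧸ p := Ideal.Quotient.mkₐ k p
    let π : MvPolynomial V k →ₐ[k] srRing k Δ := Ideal.Quotient.mkₐ k (srIdeal k Δ)
    let φ : MvPolynomial F k →ₐ[k] srRing k Δ ⧸ p :=
      MvPolynomial.aeval fun v : F => q (srVar k Δ v)
    let ψ : MvPolynomial V k →ₐ[k] MvPolynomial F k :=
      MvPolynomial.aeval fun v => if h : v ∈ F then MvPolynomial.X ⟨v, h⟩ else 0
    have h : φ.comp ψ = q.comp π := by
      apply MvPolynomial.algHom_ext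
      intro v
      by_cases hv : v ∈ F
      · simp [φ, ψ, hv]
        rfl
      · have : q (srVar k Δ v) = 0 := by
          have : srVar k Δ v ∈ p := by simpa [F] using hv
          exact Ideal.Quotient.eq_zero_iff_mem.mpr this
        simp [φ, ψ, hv]
        exact this.symm
    rw [← ringKrullDim_mvPolynomial_finset (k := k)]
    refine ringKrullDim_le_of_surjective φ.toRingHom fun x => ?_
    obtain ⟨y, rfl⟩ := Ideal.Quotient.mk_surjective x
    obtain ⟨z, rfl⟩ := Ideal.Quotient.mk_surjective y
    exact ⟨ψ z, DFunLike.congr_fun h z⟩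

theorem ringKrullDim_srRing_eq {Δ : SComplex V} {F : Finset V} (hF : F ∈ Δ.faces)
    (hmax : ∀ G ∈ Δ.faces, G.card ≤ F.card) : ringKrullDim (srRing k Δ) = (F.card : ℕ) := by
  refine le_antisymm (iSup_le fun p => ?_) (card_le_ringKrullDim_srRing hF)
  obtain ⟨G, hG, hle⟩ := exists_ringKrullDim_quotient_le_card Δ p.head.asIdeal
  refine le_trans (le_trans ?_ hle) (by exact_mod_cast hmax G hG)
  rw [ringKrullDim_quotient]
  let p' : LTSeries (PrimeSpectrum.zeroLocus (p.head.asIdeal : Set (srRing k Δ))) :=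
    { length := p.length
      toFun := fun i => ⟨p i, LTSeries.head_le p i⟩
      step := p.step }
  exact Order.LTSeries.length_le_krullDim p'

theorem exists_face_card_max {Δ : SComplex V} (h : ∅ ∈ Δ.faces) :
    ∃ F ∈ Δ.faces, ∀ G ∈ Δ.faces, G.card ≤ F.card :=
  Set.exists_max_image Δ.faces Finset.card (Set.toFinite _) ⟨∅, h⟩

end Dimension

namespace SComplex

theorem mem_vertexSet_of_mem_face {Δ : SComplex V} {F : Finset V} (hF : F ∈ Δ.faces) {v : V}
    (hv : v ∈ F) : v ∈ Δ.vertexSet :=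
  Δ.down_closed hF (Finset.singleton_subset_iff.mpr hv)

variable [DecidableEq V] {Δ₁ Δ₂ : SComplex V}

open Classical in
theorem mem_join_faces_iff (hdisj : Disjoint Δ₁.vertexSet Δ₂.vertexSet) {F : Finset V} :
    F ∈ (Δ₁.join Δ₂).faces ↔
      {v ∈ F | v ∈ Δ₁.vertexSet} ∈ Δ₁.faces ∧ {v ∈ F | v ∉ Δ₁.vertexSet} ∈ Δ₂.faces := by
  constructor
  · rintro ⟨G, hG, H, hH, rfl⟩
    refine ⟨Δ₁.down_closed hG fun v hv => ?_, Δ₂.down_closed hH fun v hv => ?_⟩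
    · simp only [Finset.mem_filter, Finset.mem_union] at hv
      exact hv.1.resolve_right fun h =>
        Set.disjoint_left.mp hdisj hv.2 (mem_vertexSet_of_mem_face hH h)
    · simp only [Finset.mem_filter, Finset.mem_union] at hv
      exact hv.1.resolve_left fun h => hv.2 (mem_vertexSet_of_mem_face hG h)
  · rintro ⟨h1, h2⟩
    refine ⟨_, h1, _, h2, ?_⟩
    ext v
    simp only [Finset.mem_union, Finset.mem_filter]
    tauto

theorem mem_faces_of_mem_join_left (hdisj : Disjoint Δ₁.vertexSet Δ₂.vertexSet) {F : Finset V}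
    (hF : F ∈ (Δ₁.join Δ₂).faces) (h : ∀ v ∈ F, v ∈ Δ₁.vertexSet) : F ∈ Δ₁.faces := by
  classical
  have := ((mem_join_faces_iff hdisj).mp hF).1
  rwa [Finset.filter_true_of_mem h] at this

theorem mem_faces_of_mem_join_right (hdisj : Disjoint Δ₁.vertexSet Δ₂.vertexSet) {F : Finset V}
    (hF : F ∈ (Δ₁.join Δ₂).faces) (h : ∀ v ∈ F, v ∉ Δ₁.vertexSet) : F ∈ Δ₂.faces := by
  classical
  have := ((mem_join_faces_iff hdisj).mp hF).2
  rwa [Finset.filter_true_of_mem h] at this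

end SComplex

section Join

variable [DecidableEq V] {Δ₁ Δ₂ : SComplex V}

theorem ringKrullDim_srRing_join [Fintype V] (hdisj : Disjoint Δ₁.vertexSet Δ₂.vertexSet)
    {F G : Finset V} (hF : F ∈ Δ₁.faces) (hFmax : ∀ H ∈ Δ₁.faces, H.card ≤ F.card)
    (hG : G ∈ Δ₂.faces) (hGmax : ∀ H ∈ Δ₂.faces, H.card ≤ G.card) :
    ringKrullDim (srRing k (Δ₁.join Δ₂)) = (F.card + G.card : ℕ) := by
  have hFG : Disjoint F G := Finset.disjoint_left.mpr fun v hvF hvG =>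
    Set.disjoint_left.mp hdisj (SComplex.mem_vertexSet_of_mem_face hF hvF)
      (SComplex.mem_vertexSet_of_mem_face hG hvG)
  rw [← Finset.card_union_of_disjoint hFG]
  refine ringKrullDim_srRing_eq ⟨F, hF, G, hG, rfl⟩ ?_
  rintro _ ⟨F', hF', G', hG', rfl⟩
  rw [Finset.card_union_of_disjoint hFG]
  exact (Finset.card_union_le _ _).trans (add_le_add (hFmax _ hF') (hGmax _ hG'))

open Classical in
/-- The map `k[Δ₁] → k[Δ₁ ∗ Δ₂]` sending vertices to vertices. -/
noncomputable def srJoinLeft (k : Type*) [Field k]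
    (hdisj : Disjoint Δ₁.vertexSet Δ₂.vertexSet) : srRing k Δ₁ →ₐ[k] srRing k (Δ₁.join Δ₂) :=
  srLift Δ₁ (fun v => if v ∈ Δ₁.vertexSet then srVar k (Δ₁.join Δ₂) v else 0) <| by
    intro F hF
    by_cases h : ∀ v ∈ F, v ∈ Δ₁.vertexSet
    · rw [Finset.prod_congr rfl fun v hv => if_pos (h v hv)]
      exact prod_srVar_eq_zero fun hF' => hF (SComplex.mem_faces_of_mem_join_left hdisj hF' h)
    · push Not at h
      obtain ⟨v, hv, hv'⟩ := h
      exact Finset.prod_eq_zero hv (if_neg hv')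

open Classical in
/-- The map `k[Δ₂] → k[Δ₁ ∗ Δ₂]` sending vertices to vertices. -/
noncomputable def srJoinRight (k : Type*) [Field k]
    (hdisj : Disjoint Δ₁.vertexSet Δ₂.vertexSet) : srRing k Δ₂ →ₐ[k] srRing k (Δ₁.join Δ₂) :=
  srLift Δ₂ (fun v => if v ∈ Δ₂.vertexSet then srVar k (Δ₁.join Δ₂) v else 0) <| by
    intro F hF
    by_cases h : ∀ v ∈ F, v ∈ Δ₂.vertexSet
    · rw [Finset.prod_congr rfl fun v hv => if_pos (h v hv)]
      exact prod_srVar_eq_zero fun hF' => hF (SComplex.mem_faces_of_mem_join_right hdisj hF'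
        fun v hv => Set.disjoint_right.mp hdisj (h v hv))
    · push Not at h
      obtain ⟨v, hv, hv'⟩ := h
      exact Finset.prod_eq_zero hv (if_neg hv')

/-- The map `k[Δ₁ ∗ Δ₂] → k[Δ₁] ⊗ k[Δ₂]` sending `x_v` to `x_v ⊗ 1 + 1 ⊗ x_v`. -/
noncomputable def srOfJoin (k : Type*) [Field k]
    (hdisj : Disjoint Δ₁.vertexSet Δ₂.vertexSet) :
    srRing k (Δ₁.join Δ₂) →ₐ[k] srRing k Δ₁ ⊗[k] srRing k Δ₂ :=
  srLift (Δ₁.join Δ₂) (fun v => srVar k Δ₁ v ⊗ₜ[k] 1 + 1 ⊗ₜ[k] srVar k Δ₂ v) <| by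
    classical
    intro F hF
    rw [SComplex.mem_join_faces_iff hdisj, not_and_or] at hF
    rcases hF with hF | hF
    · exact prod_tmul_one_add_eq_zero_left (Finset.filter_subset _ F) (prod_srVar_eq_zero hF)
        fun v hv => srVar_eq_zero (Set.disjoint_left.mp hdisj (Finset.mem_filter.mp hv).2)
    · exact prod_tmul_one_add_eq_zero_right (Finset.filter_subset _ F) (prod_srVar_eq_zero hF)
        fun v hv => srVar_eq_zero (Finset.mem_filter.mp hv).2

theorem srVar_join_eq_zero (hdisj : Disjoint Δ₁.vertexSet Δ₂.vertexSet) {v : V}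
    (h1 : v ∉ Δ₁.vertexSet) (h2 : v ∉ Δ₂.vertexSet) : srVar k (Δ₁.join Δ₂) v = 0 :=
  srVar_eq_zero fun h => h2 (SComplex.mem_faces_of_mem_join_right hdisj h (by simpa using h1))

/-- The Stanley–Reisner ring of a join is the tensor product of the Stanley–Reisner rings. -/
noncomputable def srJoinEquiv (k : Type*) [Field k]
    (hdisj : Disjoint Δ₁.vertexSet Δ₂.vertexSet) :
    srRing k Δ₁ ⊗[k] srRing k Δ₂ ≃ₐ[k] srRing k (Δ₁.join Δ₂) :=
  AlgEquiv.ofAlgHom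
    (Algebra.TensorProduct.productMap (srJoinLeft k hdisj) (srJoinRight k hdisj))
    (srOfJoin k hdisj)
    (by
      apply srRing_algHom_ext
      intro v
      by_cases h1 : v ∈ Δ₁.vertexSet
      · simp [srOfJoin, srJoinLeft, srJoinRight, h1, Set.disjoint_left.mp hdisj h1]
      · by_cases h2 : v ∈ Δ₂.vertexSet
        · simp [srOfJoin, srJoinLeft, srJoinRight, h1, h2]
        · simp [srOfJoin, srJoinLeft, srJoinRight, srVar_join_eq_zero hdisj h1 h2])
    (by
      apply Algebra.TensorProduct.ext
      · apply srRing_algHom_ext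
        intro v
        by_cases h1 : v ∈ Δ₁.vertexSet
        · simp [srOfJoin, srJoinLeft, h1,
            srVar_eq_zero (k := k) (Set.disjoint_left.mp hdisj h1)]
        · simp [srVar_eq_zero (k := k) h1]
      · apply srRing_algHom_ext
        intro v
        by_cases h2 : v ∈ Δ₂.vertexSet
        · simp [srOfJoin, srJoinRight, h2,
            srVar_eq_zero (k := k) (Set.disjoint_right.mp hdisj h2)]
        · simp [srVar_eq_zero (k := k) h2])

theorem map_tensorIdeal_le (hdisj : Disjoint Δ₁.vertexSet Δ₂.vertexSet) :
    (tensorIdeal k (srIrrelevant k Δ₁) (srIrrelevant k Δ₂)).map (srJoinEquiv k hdisj).toRingEquiv ≤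
      srIrrelevant k (Δ₁.join Δ₂) := by
  classical
  rw [Ideal.map_le_iff_le_comap, tensorIdeal, sup_le_iff, Ideal.map_le_iff_le_comap,
    Ideal.map_le_iff_le_comap, srIrrelevant_eq_span Δ₁, srIrrelevant_eq_span Δ₂, Ideal.span_le,
    Ideal.span_le]
  constructor
  · rintro _ ⟨v, rfl⟩
    have : srJoinEquiv k hdisj (srVar k Δ₁ v ⊗ₜ 1) ∈ srIrrelevant k (Δ₁.join Δ₂) := by
      by_cases h : v ∈ Δ₁.vertexSet
      · simp [srJoinEquiv, srJoinLeft, h, srVar_mem_srIrrelevant]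
      · simp [srVar_eq_zero (k := k) h]
    exact this
  · rintro _ ⟨v, rfl⟩
    have : srJoinEquiv k hdisj (1 ⊗ₜ srVar k Δ₂ v) ∈ srIrrelevant k (Δ₁.join Δ₂) := by
      by_cases h : v ∈ Δ₂.vertexSet
      · simp [srJoinEquiv, srJoinRight, h, srVar_mem_srIrrelevant]
      · simp [srVar_eq_zero (k := k) h]
    exact this

theorem map_srIrrelevant_join_le (hdisj : Disjoint Δ₁.vertexSet Δ₂.vertexSet) :
    (srIrrelevant k (Δ₁.join Δ₂)).map (srJoinEquiv k hdisj).toRingEquiv.symm ≤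
      tensorIdeal k (srIrrelevant k Δ₁) (srIrrelevant k Δ₂) := by
  rw [Ideal.map_le_iff_le_comap, srIrrelevant_eq_span, Ideal.span_le]
  rintro _ ⟨v, rfl⟩
  have : (srJoinEquiv k hdisj).symm (srVar k (Δ₁.join Δ₂) v) =
      srVar k Δ₁ v ⊗ₜ 1 + 1 ⊗ₜ srVar k Δ₂ v := by
    simp [srJoinEquiv, srOfJoin]
  have hmem : (srJoinEquiv k hdisj).symm (srVar k (Δ₁.join Δ₂) v) ∈
      tensorIdeal k (srIrrelevant k Δ₁) (srIrrelevant k Δ₂) := by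
    rw [this]
    exact add_mem
      (Ideal.mem_sup_left (Ideal.mem_map_of_mem _ (srVar_mem_srIrrelevant Δ₁ v)))
      (Ideal.mem_sup_right (Ideal.mem_map_of_mem _ (srVar_mem_srIrrelevant Δ₂ v)))
  exact hmem

theorem isCM_join_iff_of_empty_mem [Fintype V] (hdisj : Disjoint Δ₁.vertexSet Δ₂.vertexSet)
    (h1 : ∅ ∈ Δ₁.faces) (h2 : ∅ ∈ Δ₂.faces) :
    (Δ₁.join Δ₂).IsCM k ↔ (Δ₁.IsCM k ∧ Δ₂.IsCM k) := by
  obtain ⟨F, hF, hFmax⟩ := exists_face_card_max h1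
  obtain ⟨G, hG, hGmax⟩ := exists_face_card_max h2
  let e := (srJoinEquiv k hdisj).toRingEquiv
  have : IsNoetherianRing (srRing k Δ₁ ⊗[k] srRing k Δ₂) := isNoetherianRing_of_ringEquiv _ e.symm
  have hdim : ringKrullDim (srRing k Δ₁ ⊗[k] srRing k Δ₂) = (F.card + G.card : ℕ) := by
    rw [ringKrullDim_eq_of_ringEquiv e, ringKrullDim_srRing_join hdisj hF hFmax hG hGmax]
  have hiff := hasFullRegularSequence_tensorProduct_iff (k := k) (srIrrelevant_ne_top (k := k) h1)
    (srIrrelevant_ne_top (k := k) h2) (ringKrullDim_srRing_eq hF hFmax)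
    (ringKrullDim_srRing_eq hG hGmax) hdim
  rw [isCM_iff, isCM_iff, isCM_iff, ← hiff]
  exact ⟨HasFullRegularSequence.of_ringEquiv e.symm (map_srIrrelevant_join_le hdisj),
    HasFullRegularSequence.of_ringEquiv e (map_tensorIdeal_le hdisj)⟩

end Join

theorem SComplex.IsCM.empty_mem_faces {Δ : SComplex V} (h : Δ.IsCM k) : ∅ ∈ Δ.faces := by
  obtain ⟨rs, -, hrs, -⟩ := h
  exact empty_mem_faces_of_nontrivial (k := k) hrs.nontrivial

end StanleyReisner

/-- The join of two simplicial complexes on disjoint vertex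
sets is Cohen–Macaulay over a field `k` iff both complexes are. -/
theorem join_isCM_iff {V : Type*} [DecidableEq V] [Fintype V] (k : Type*) [Field k]
    (Δ₁ Δ₂ : SComplex V) (hdisj : Disjoint Δ₁.vertexSet Δ₂.vertexSet) :
    (Δ₁.join Δ₂).IsCM k ↔ (Δ₁.IsCM k ∧ Δ₂.IsCM k) := by
  constructor
  · intro h
    obtain ⟨F, hF, G, hG, -⟩ := h.empty_mem_faces
    exact (isCM_join_iff_of_empty_mem hdisj (Δ₁.down_closed hF F.empty_subset)
      (Δ₂.down_closed hG G.empty_subset)).mp h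
  · rintro ⟨h1, h2⟩
    exact (isCM_join_iff_of_empty_mem hdisj h1.empty_mem_faces h2.empty_mem_faces).mpr ⟨h1, h2⟩
end

section
/- Let d ≥ 2, let u ≥ v be squarefree monomials of degree d in k[x₁,…,xₙ] with u = x_i x_{i₂} ⋯ x_{i_d}, i < i₂ < ⋯ < i_d, let Δ be the simplicial complex on [n] with I_Δ = (L(u,v)), let Δ₁ be the full simplex on {1,…,i−1}, and let Δ₂ be the complex of the ideal generated by L(u,v) in k[x_i,…,xₙ]. Then Δ is disconnected if and only if Δ₁ is the empty complex (i.e., i = 1) and Δ₂ is disconnected. -/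
open Finset

section GroundSet

/-- The squarefree monomial `∏_{i ∈ S} xᵢ` in the polynomial ring whose
variables are indexed by the ground set `W ⊆ ℕ`. -/
noncomputable def monoW (k : Type*) [CommRing k] (W S : Finset ℕ) :
    MvPolynomial {x // x ∈ W} k :=
  ∏ i ∈ S.subtype (· ∈ W), MvPolynomial.X i

/-- The Stanley–Reisner ideal of a complex `Δ` with ground (vertex) set `W ⊆ ℕ`,
inside the polynomial ring `k[xᵢ : i ∈ W]`: it is generated by the squarefree
monomials of the non-faces contained in `W`. -/
noncomputable def srIdealW (k : Type*) [CommRing k] (W : Finset ℕ) (Δ : SComplex ℕ) :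
    Ideal (MvPolynomial {x // x ∈ W} k) :=
  Ideal.span {p | ∃ F : Finset ℕ, F ⊆ W ∧ F ∉ Δ.faces ∧ p = monoW k W F}

/-- The Stanley–Reisner ring `k[Δ]` of a complex with ground set `W ⊆ ℕ`. -/
abbrev srRingW (k : Type*) [CommRing k] (W : Finset ℕ) (Δ : SComplex ℕ) :=
  MvPolynomial {x // x ∈ W} k ⧸ srIdealW k W Δ

/-- The irrelevant maximal ideal of the Stanley–Reisner ring. -/
noncomputable def srIrrelevantW (k : Type*) [CommRing k] (W : Finset ℕ)
    (Δ : SComplex ℕ) : Ideal (srRingW k W Δ) :=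
  (Ideal.span (Set.range (MvPolynomial.X : {x // x ∈ W} → MvPolynomial {x // x ∈ W} k))).map
    (Ideal.Quotient.mk (srIdealW k W Δ))

/-- `Δ` (a complex with ground set `W ⊆ ℕ`) is Cohen–Macaulay over the field `k`:
the ring `k[Δ]` admits a regular sequence, inside the irrelevant maximal ideal,
whose length equals the Krull dimension of `k[Δ]`. -/
def IsCMW (k : Type*) [Field k] (W : Finset ℕ) (Δ : SComplex ℕ) : Prop :=
  ∃ rs : List (srRingW k W Δ), (∀ r ∈ rs, r ∈ srIrrelevantW k W Δ) ∧
    RingTheory.Sequence.IsRegular (srRingW k W Δ) rs ∧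
    ringKrullDim (srRingW k W Δ) = (rs.length : WithBot ℕ∞)

/-- `Δ` is `CM_t` (Cohen–Macaulay in codimension `t`) over `k`: `Δ` is pure and
`link_Δ(F)` is Cohen–Macaulay over `k` for every face `F` with `#F ≥ t`.
`CM_1` is the Buchsbaum property. -/
def IsCMtW (k : Type*) [Field k] (W : Finset ℕ) (t : ℕ) (Δ : SComplex ℕ) : Prop :=
  Δ.Pure ∧ ∀ F ∈ Δ.faces, t ≤ F.card → IsCMW k W (Δ.link F)

end GroundSet

section Lex

/-- Comparison of squarefree monomials of the same degree in the lexicographic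
order with `x₁ > x₂ > ⋯ > xₙ`, the monomials being identified with their
supports: `u >_lex v` iff the smallest variable index where they differ
belongs to `u`. -/
def lexGT (A B : Finset ℕ) : Prop :=
  ∃ m ∈ A, m ∉ B ∧ ∀ x < m, (x ∈ A ↔ x ∈ B)

/-- `u ≥_lex v` for squarefree monomials identified with their supports. -/
def lexGE (A B : Finset ℕ) : Prop := A = B ∨ lexGT A B

/-- The lexsegment `L(u,v)` of squarefree monomials of degree `d` in
`x₁, …, xₙ`, the monomials being identified with their supports:
all `S ⊆ [n] = {1, …, n}` with `#S = d` and `u ≥_lex S ≥_lex v`. -/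
def lexSegment (n d : ℕ) (U V₀ : Finset ℕ) : Set (Finset ℕ) :=
  {S | S ⊆ Finset.Icc 1 n ∧ S.card = d ∧ lexGE U S ∧ lexGE S V₀}

/-- The ideal of `k[xᵢ : i ∈ W]` generated by the squarefree monomials of the
lexsegment `L(u,v)` (of degree-`d` squarefree monomials in `x₁, …, xₙ`). -/
noncomputable def lexIdealW (k : Type*) [CommRing k] (W : Finset ℕ) (n d : ℕ)
    (U V₀ : Finset ℕ) : Ideal (MvPolynomial {x // x ∈ W} k) :=
  Ideal.span {p | ∃ S ∈ lexSegment n d U V₀, p = monoW k W S}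

end Lex

/-- A squarefree monomial lying in an ideal generated by squarefree monomials is a multiple of
one of the generators. -/
theorem exists_subset_of_monoW_mem_span {k : Type*} [Field k] {W F : Finset ℕ}
    {T : Set (Finset ℕ)} (hT : ∀ S ∈ T, S ⊆ W)
    (h : monoW k W F ∈ Ideal.span {p | ∃ S ∈ T, p = monoW k W S}) :
    ∃ S ∈ T, S ⊆ F := by
  classical
  by_contra! hcon
  let φ : MvPolynomial {x // x ∈ W} k →+* k :=
    MvPolynomial.eval fun x => if (x : ℕ) ∈ F then 1 else 0
  have hker : Ideal.span {p | ∃ S ∈ T, p = monoW k W S} ≤ RingHom.ker φ := by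
    rw [Ideal.span_le]
    rintro _ ⟨S, hS, rfl⟩
    obtain ⟨x, hxS, hxF⟩ := Finset.not_subset.mp (hcon S hS)
    have hx : (⟨x, hT S hS hxS⟩ : {x // x ∈ W}) ∈ S.subtype (· ∈ W) := by
      simpa using hxS
    rw [SetLike.mem_coe, RingHom.mem_ker, monoW, map_prod]
    exact Finset.prod_eq_zero hx (by simp [φ, hxF])
  have h_one : φ (monoW k W F) = 1 := by
    rw [monoW, map_prod]
    refine Finset.prod_eq_one fun x hx => ?_
    simp [φ, Finset.mem_subtype.mp hx]
  exact one_ne_zero (h_one.symm.trans (RingHom.mem_ker.mp (hker h)))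

/-- The faces of a complex are recovered from its Stanley–Reisner ideal. -/
theorem monoW_mem_srIdealW_iff {k : Type*} [Field k] {W F : Finset ℕ} (hF : F ⊆ W)
    (Δ : SComplex ℕ) : monoW k W F ∈ srIdealW k W Δ ↔ F ∉ Δ.faces := by
  refine ⟨fun h hmem => ?_, fun h => Ideal.subset_span ⟨F, hF, h, rfl⟩⟩
  obtain ⟨S, ⟨-, hS⟩, hSF⟩ := exists_subset_of_monoW_mem_span
    (T := {S | S ⊆ W ∧ S ∉ Δ.faces}) (fun S hS => hS.1)
    (by simpa only [srIdealW, Set.mem_ofPred_eq, and_assoc] using h)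
  exact hS (Δ.down_closed hmem hSF)

theorem faces_eq_of_srIdealW_eq {k : Type*} [Field k] {W : Finset ℕ} {Δ Δ' : SComplex ℕ}
    (hΔ : ∀ F ∈ Δ.faces, F ⊆ W) (hΔ' : ∀ F ∈ Δ'.faces, F ⊆ W)
    (h : srIdealW k W Δ = srIdealW k W Δ') : Δ.faces = Δ'.faces := by
  ext F
  by_cases hF : F ⊆ W
  · rw [← not_iff_not, ← monoW_mem_srIdealW_iff (k := k) hF, h, monoW_mem_srIdealW_iff hF]
  · exact iff_of_false (fun hm => hF (hΔ F hm)) (fun hm => hF (hΔ' F hm))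

theorem le_of_lexGE {i x : ℕ} {U S : Finset ℕ} (h : lexGE U S) (hU : ∀ m ∈ U, i ≤ m)
    (hx : x ∈ S) : i ≤ x := by
  rcases h with rfl | ⟨m, hm, -, hlt⟩
  · exact hU x hx
  · by_contra! hxi
    exact hxi.not_ge (hU x ((hlt x (hxi.trans_le (hU m hm))).mpr hx))

/-- A complex with a vertex adjacent to all the others is connected. -/
theorem SComplex.connected_of_forall_pair {V : Type*} [DecidableEq V] {Δ : SComplex V} {c : V}
    (hc : {c} ∈ Δ.faces) (h : ∀ x, {x} ∈ Δ.faces → {c, x} ∈ Δ.faces) : Δ.Connected := by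
  refine ⟨⟨c, hc⟩, fun a b ha hb => Relation.ReflTransGen.trans (b := c) ?_ ?_⟩
  · by_cases hac : a = c
    · rw [hac]
    · exact .single ⟨hac, Finset.pair_comm c a ▸ h a ha⟩
  · by_cases hcb : c = b
    · rw [hcb]
    · exact .single ⟨hcb, h b hb⟩

/-- In the lexsegment setting, `Δ` is disconnected iff `Δ₁` is
the empty complex (i.e. `i = 1`) and `Δ₂` is disconnected. -/
theorem lexsegment_disconnected_iff (k : Type*) [Field k] (n d i : ℕ) (hd : 2 ≤ d)
    (U V₀ : Finset ℕ) (hUsub : U ⊆ Finset.Icc 1 n) (hVsub : V₀ ⊆ Finset.Icc 1 n)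
    (hUcard : U.card = d) (hVcard : V₀.card = d) (huv : lexGE U V₀)
    (hiU : i ∈ U) (himin : ∀ m ∈ U, i ≤ m)
    (Δ : SComplex ℕ) (hΔsub : ∀ F ∈ Δ.faces, F ⊆ Finset.Icc 1 n)
    (hΔ : srIdealW k (Finset.Icc 1 n) Δ = lexIdealW k (Finset.Icc 1 n) n d U V₀)
    (Δ₂ : SComplex ℕ) (hΔ₂sub : ∀ F ∈ Δ₂.faces, F ⊆ Finset.Icc i n)
    (hΔ₂ : srIdealW k (Finset.Icc i n) Δ₂ = lexIdealW k (Finset.Icc i n) n d U V₀) :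
    ¬ Δ.Connected ↔
      ((SComplex.simplexOn (Finset.Icc 1 (i - 1)) : SComplex ℕ).faces = {(∅ : Finset ℕ)} ∧
        ¬ Δ₂.Connected) := by
  have hi := Finset.mem_Icc.mp (hUsub hiU)
  rcases hi.1.eq_or_lt with rfl | hi1
  · have hfaces := faces_eq_of_srIdealW_eq hΔsub hΔ₂sub (hΔ.trans hΔ₂.symm)
    have hempty : (SComplex.simplexOn (Finset.Icc 1 (1 - 1)) : SComplex ℕ).faces = {∅} := by
      ext F
      simp [SComplex.simplexOn]
    simp only [SComplex.Connected, hfaces, hempty, true_and]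
  · have hpair : ∀ x ∈ Finset.Icc 1 n, {1, x} ∈ Δ.faces := by
      intro x hx
      have hsub : {1, x} ⊆ Finset.Icc 1 n := by
        rw [Finset.insert_subset_iff, Finset.singleton_subset_iff]
        exact ⟨Finset.mem_Icc.mpr ⟨le_rfl, hi.1.trans hi.2⟩, hx⟩
      by_contra hnot
      rw [← monoW_mem_srIdealW_iff (k := k) hsub, hΔ] at hnot
      obtain ⟨S, ⟨-, hcard, hUS, -⟩, hS⟩ :=
        exists_subset_of_monoW_mem_span (fun S hS => hS.1) hnot
      have h_one : 1 ∉ S := fun h => hi1.not_ge (le_of_lexGE hUS himin h)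
      have hle := Finset.card_le_card ((Finset.subset_insert_iff_of_notMem h_one).mp hS)
      rw [Finset.card_singleton] at hle
      omega
    have hconn : Δ.Connected := SComplex.connected_of_forall_pair (c := 1)
      (Δ.down_closed (hpair i (hUsub hiU)) (by simp))
      (fun x hx => hpair x (hΔsub _ hx (Finset.mem_singleton_self x)))
    refine iff_of_false (not_not.mpr hconn) fun ⟨h, _⟩ => ?_
    have hmem : ({1} : Finset ℕ) ∈
        (SComplex.simplexOn (Finset.Icc 1 (i - 1)) : SComplex ℕ).faces :=
      Finset.singleton_subset_iff.mpr (Finset.mem_Icc.mpr ⟨le_rfl, Nat.le_sub_one_of_lt hi1⟩)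
    rw [h] at hmem
    exact Finset.singleton_ne_empty 1 hmem
end

section
/- Let d ≥ 2, let u ≥ v be squarefree monomials of degree d in k[x₁,…,xₙ] with u = x_i x_{i₂} ⋯ x_{i_d}, i < i₂ < ⋯ < i_d, let Δ be the simplicial complex on [n] with I_Δ = (L(u,v)), let Δ₁ be the full simplex on {1,…,i−1}, and let Δ₂ be the complex of the ideal generated by L(u,v) in k[x_i,…,xₙ]. Then Δ is pure if and only if Δ₂ is pure. -/
open Finset

namespace SComplex

variable {V : Type*} [DecidableEq V]

/-- The facets of the join of the full simplex on `A` with a complex on vertices outside `A`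
are the unions of `A` with the facets of that complex. -/
theorem isFacet_join_simplexOn_iff {A : Finset V} {Γ : SComplex V}
    (hdis : ∀ G ∈ Γ.faces, Disjoint A G) (H : Finset V) :
    ((simplexOn A).join Γ).IsFacet H ↔ ∃ G, Γ.IsFacet G ∧ H = A ∪ G := by
  constructor
  · rintro ⟨⟨F, hF, G, hG, rfl⟩, hmax⟩
    have hFA : F ∪ G = A ∪ G :=
      hmax _ ⟨A, Subset.refl A, G, hG, rfl⟩ (union_subset_union_left hF)
    refine ⟨G, ⟨hG, fun G' hG' hGG' => ?_⟩, hFA⟩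
    have h : A ∪ G = A ∪ G' := hFA ▸ hmax _ ⟨A, Subset.refl A, G', hG', rfl⟩
      (union_subset_union hF hGG')
    rw [← union_sdiff_cancel_left (hdis G hG), h, union_sdiff_cancel_left (hdis G' hG')]
  · rintro ⟨G, ⟨hG, hmax⟩, rfl⟩
    refine ⟨⟨A, Subset.refl A, G, hG, rfl⟩, ?_⟩
    rintro _ ⟨F, hF, G', hG', rfl⟩ hsub
    have hGG' : G ⊆ G' := fun x hx => by
      rcases mem_union.mp (hsub (mem_union_right _ hx)) with h | h
      · exact absurd hx (disjoint_left.mp (hdis G hG) (hF h))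
      · exact h
    obtain rfl := hmax G' hG' hGG'
    exact hsub.antisymm (union_subset_union_left hF)

/-- Joining with a full simplex on new vertices does not affect purity. -/
theorem pure_join_simplexOn_iff {A : Finset V} {Γ : SComplex V}
    (hdis : ∀ G ∈ Γ.faces, Disjoint A G) :
    ((simplexOn A).join Γ).Pure ↔ Γ.Pure := by
  constructor
  · intro h F G hF hG
    have := h ((isFacet_join_simplexOn_iff hdis _).mpr ⟨F, hF, rfl⟩)
      ((isFacet_join_simplexOn_iff hdis _).mpr ⟨G, hG, rfl⟩)
    rw [card_union_of_disjoint (hdis F hF.1), card_union_of_disjoint (hdis G hG.1)] at this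
    omega
  · intro h H H' hH hH'
    obtain ⟨F, hF, rfl⟩ := (isFacet_join_simplexOn_iff hdis _).mp hH
    obtain ⟨G, hG, rfl⟩ := (isFacet_join_simplexOn_iff hdis _).mp hH'
    rw [card_union_of_disjoint (hdis F hF.1), card_union_of_disjoint (hdis G hG.1), h hF hG]

end SComplex

theorem monoW_eq_monomial (k : Type*) [CommRing k] (W S : Finset ℕ) :
    monoW k W S =
      MvPolynomial.monomial (Finsupp.indicator (S.subtype (· ∈ W)) fun _ _ => 1) 1 := by
  rw [monoW, Finsupp.indicator_eq_sum_single, MvPolynomial.monomial_sum_one]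
  rfl

/-- A squarefree monomial lies in the ideal generated by a set of squarefree monomials iff it
is divisible by one of them. -/
theorem monoW_mem_span_iff (k : Type*) [CommRing k] [Nontrivial k] {W : Finset ℕ}
    {𝒮 : Set (Finset ℕ)} (h𝒮 : ∀ S ∈ 𝒮, S ⊆ W) (F : Finset ℕ) :
    monoW k W F ∈ Ideal.span {p | ∃ S ∈ 𝒮, p = monoW k W S} ↔ ∃ S ∈ 𝒮, S ⊆ F := by
  have himage : {p | ∃ S ∈ 𝒮, p = monoW k W S} =
      (fun s => MvPolynomial.monomial s (1 : k)) ''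
        ((fun S => Finsupp.indicator (S.subtype (· ∈ W)) fun _ _ => 1) '' 𝒮) := by
    ext p
    simp only [Set.mem_ofPred_eq, Set.mem_image, exists_exists_and_eq_and, monoW_eq_monomial,
      eq_comm (a := p)]
  classical
  rw [himage, MvPolynomial.mem_ideal_span_monomial_image, monoW_eq_monomial,
    MvPolynomial.support_monomial, if_neg one_ne_zero]
  simp only [mem_singleton, forall_eq, Set.exists_mem_image]
  refine exists_congr fun S => and_congr_right fun hS => ⟨fun h x hx => ?_, fun h x => ?_⟩
  · by_contra hxF
    simpa [Finsupp.indicator_apply, hx, hxF] using h ⟨x, h𝒮 S hS hx⟩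
  · by_cases hx : (x : ℕ) ∈ S
    · simp [Finsupp.indicator_apply, hx, h hx]
    · simp [Finsupp.indicator_apply, hx]

/-- The faces of a complex whose Stanley–Reisner ideal is generated by given squarefree
monomials are the sets containing none of their supports. -/
theorem mem_faces_iff_of_srIdealW_eq (k : Type*) [CommRing k] [Nontrivial k] {W : Finset ℕ}
    {𝒮 : Set (Finset ℕ)} (h𝒮 : ∀ S ∈ 𝒮, S ⊆ W) {Δ : SComplex ℕ}
    (hsub : ∀ F ∈ Δ.faces, F ⊆ W)
    (hΔ : srIdealW k W Δ = Ideal.span {p | ∃ S ∈ 𝒮, p = monoW k W S}) (F : Finset ℕ) :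
    F ∈ Δ.faces ↔ F ⊆ W ∧ ∀ S ∈ 𝒮, ¬ S ⊆ F := by
  have hsr : srIdealW k W Δ =
      Ideal.span {p | ∃ S ∈ {S | S ⊆ W ∧ S ∉ Δ.faces}, p = monoW k W S} := by
    simp only [srIdealW, Set.mem_ofPred_eq, and_assoc]
  have key : (∃ S ∈ {S | S ⊆ W ∧ S ∉ Δ.faces}, S ⊆ F) ↔ ∃ S ∈ 𝒮, S ⊆ F := by
    rw [← monoW_mem_span_iff k (fun S hS => hS.1) F, ← hsr, hΔ, monoW_mem_span_iff k h𝒮]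
  constructor
  · intro hF
    refine ⟨hsub F hF, fun S hS hSF => ?_⟩
    obtain ⟨T, hT, hTF⟩ := key.mpr ⟨S, hS, hSF⟩
    exact hT.2 (Δ.down_closed hF hTF)
  · rintro ⟨hFW, hF⟩
    by_contra hFΔ
    obtain ⟨S, hS, hSF⟩ := key.mp ⟨F, ⟨hFW, hFΔ⟩, subset_rfl⟩
    exact hF S hS hSF

/-- The minimum of a set does not decrease when passing to a lexicographically smaller one. -/
theorem le_of_mem_of_lexGE {A B : Finset ℕ} (h : lexGE A B) {i : ℕ} (hA : ∀ m ∈ A, i ≤ m) :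
    ∀ m ∈ B, i ≤ m := by
  rcases h with rfl | ⟨m, hmA, -, hm⟩
  · exact hA
  · intro x hx
    rcases lt_or_ge x m with h | h
    · exact hA x ((hm x h).mpr hx)
    · exact (hA m hmA).trans h

/-- In the lexsegment setting, `Δ` is pure iff `Δ₂` is pure. -/
theorem lexsegment_pure_iff (k : Type*) [Field k] (n d i : ℕ) (hd : 2 ≤ d)
    (U V₀ : Finset ℕ) (hUsub : U ⊆ Finset.Icc 1 n) (hVsub : V₀ ⊆ Finset.Icc 1 n)
    (hUcard : U.card = d) (hVcard : V₀.card = d) (huv : lexGE U V₀)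
    (hiU : i ∈ U) (himin : ∀ m ∈ U, i ≤ m)
    (Δ : SComplex ℕ) (hΔsub : ∀ F ∈ Δ.faces, F ⊆ Finset.Icc 1 n)
    (hΔ : srIdealW k (Finset.Icc 1 n) Δ = lexIdealW k (Finset.Icc 1 n) n d U V₀)
    (Δ₂ : SComplex ℕ) (hΔ₂sub : ∀ F ∈ Δ₂.faces, F ⊆ Finset.Icc i n)
    (hΔ₂ : srIdealW k (Finset.Icc i n) Δ₂ = lexIdealW k (Finset.Icc i n) n d U V₀) :
    Δ.Pure ↔ Δ₂.Pure := by
  have hi : 1 ≤ i := (mem_Icc.mp (hUsub hiU)).1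
  have hL₁ : ∀ S ∈ lexSegment n d U V₀, S ⊆ Icc 1 n := fun S hS => hS.1
  have hL : ∀ S ∈ lexSegment n d U V₀, S ⊆ Icc i n := fun S hS x hx =>
    mem_Icc.mpr ⟨le_of_mem_of_lexGE hS.2.2.1 himin x hx, (mem_Icc.mp (hS.1 hx)).2⟩
  have hi_n : i ≤ n := (mem_Icc.mp (hUsub hiU)).2
  have hfaces := mem_faces_iff_of_srIdealW_eq k hL₁ hΔsub hΔ
  have hfaces₂ := mem_faces_iff_of_srIdealW_eq k hL hΔ₂sub hΔ₂
  have hdis : ∀ G ∈ Δ₂.faces, Disjoint (Ico 1 i) G := fun G hG =>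
    disjoint_left.mpr fun x hx hxG =>
      (mem_Ico.mp hx).2.not_ge (mem_Icc.mp (hΔ₂sub G hG hxG)).1
  have hjoin : Δ.faces = ((SComplex.simplexOn (Ico 1 i)).join Δ₂).faces := by
    ext H
    rw [hfaces]
    constructor
    · rintro ⟨hH, hLH⟩
      refine ⟨H ∩ Ico 1 i, inter_subset_right, H ∩ Icc i n, (hfaces₂ _).mpr
        ⟨inter_subset_right, fun S hS h => hLH S hS (h.trans inter_subset_left)⟩, ?_⟩
      rw [← inter_union_distrib_left]
      refine (inter_eq_left.mpr fun x hx => ?_).symm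
      have := mem_Icc.mp (hH hx)
      simp only [mem_union, mem_Ico, mem_Icc]
      omega
    · rintro ⟨F, hF, G, hG, rfl⟩
      obtain ⟨hGsub, hLG⟩ := (hfaces₂ G).mp hG
      refine ⟨union_subset (fun x hx => ?_) (hGsub.trans (Icc_subset_Icc_left hi)),
        fun S hS h => hLG S hS fun x hx => ?_⟩
      · have := mem_Ico.mp (hF hx)
        exact mem_Icc.mpr ⟨this.1, by omega⟩
      · rcases mem_union.mp (h hx) with hxF | hxG
        · exact absurd (mem_Icc.mp (hL S hS hx)).1 (mem_Ico.mp (hF hxF)).2.not_ge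
        · exact hxG
  rw [← SComplex.pure_join_simplexOn_iff hdis]
  simp only [SComplex.Pure, SComplex.IsFacet, hjoin]
end
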